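/- The set of sign sequences r ∈ {−1, 1}^ℕ for which height(f_r) = 1/2 is uncountable. -/

import Mathlib

/-- `phi x` is the distance from `x` to the nearest integer. -/
noncomputable def phi (x : ℝ) : ℝ := |x - round x|

/-- The signed Takagi function associated to the sign sequence `r`. -/
noncomputable def takagi (r : ℕ → ℝ) (x : ℝ) : ℝ :=
  ∑' n : ℕ, r n / 2 ^ n * phi (2 ^ n * x)

/-- The height of the graph of the signed Takagi function `f_r`:
`height(f) = max_{x ∈ [0,1]} f(x) - min_{x ∈ [0,1]} f(x)` (the function is
continuous, so the sup and inf over `[0,1]` are attained). -/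
noncomputable def heightf (r : ℕ → ℝ) : ℝ :=
  sSup (takagi r '' Set.Icc 0 1) - sInf (takagi r '' Set.Icc 0 1)

theorem phi_nonneg (x : ℝ) : 0 ≤ phi x := abs_nonneg _

theorem phi_le_half (x : ℝ) : phi x ≤ 1 / 2 := abs_sub_round x

theorem phi_le_abs_sub_intCast (x : ℝ) (z : ℤ) : phi x ≤ |x - z| := round_le x z

theorem phi_intCast (z : ℤ) : phi z = 0 := by simp [phi]

theorem phi_two_mul_le (x : ℝ) : phi (2 * x) ≤ 2 * phi x := by
  refine (phi_le_abs_sub_intCast (2 * x) (2 * round x)).trans_eq ?_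
  rw [phi, ← abs_two, ← abs_mul, abs_two]
  push_cast
  ring_nf

theorem phi_two_mul_le_one_sub (x : ℝ) : phi (2 * x) ≤ 1 - 2 * phi x := by
  have hx := abs_le.1 (abs_sub_round x)
  rcases le_total 0 (x - round x) with h | h
  · refine (phi_le_abs_sub_intCast (2 * x) (2 * round x + 1)).trans ?_
    rw [phi, abs_of_nonneg h]
    push_cast
    rw [abs_le]
    constructor <;> linarith
  · refine (phi_le_abs_sub_intCast (2 * x) (2 * round x - 1)).trans ?_
    rw [phi, abs_of_nonpos h]
    push_cast
    rw [abs_le]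
    constructor <;> linarith

theorem phi_half : phi (1 / 2) = 1 / 2 := by
  rw [phi, round_eq]
  norm_num

/-- The rescaled waves `phi (2 ^ n * x) / 2 ^ n` decrease with `n`. -/
theorem phi_two_pow_div_antitone (x : ℝ) : Antitone fun n : ℕ => phi (2 ^ n * x) / 2 ^ n := by
  refine antitone_nat_of_succ_le fun n => ?_
  have h := phi_two_mul_le (2 ^ n * x)
  rw [div_le_div_iff₀ (by positivity) (by positivity), pow_succ,
    show (2 : ℝ) ^ n * 2 * x = 2 * (2 ^ n * x) by ring]
  have h2 : (0 : ℝ) < 2 ^ n := by positivity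
  nlinarith

theorem summable_takagi {r : ℕ → ℝ} (hr : ∀ n, r n = 1 ∨ r n = -1) (x : ℝ) :
    Summable fun n : ℕ => r n / 2 ^ n * phi (2 ^ n * x) := by
  refine Summable.of_norm_bounded (summable_geometric_two) fun n => ?_
  have hn : |r n| = 1 := by rcases hr n with h | h <;> simp [h]
  rw [Real.norm_eq_abs, abs_mul, abs_div, hn, abs_of_nonneg (phi_nonneg _),
    abs_of_pos (by positivity : (0 : ℝ) < 2 ^ n), one_div_pow]
  exact mul_le_of_le_one_right (by positivity) ((phi_le_half _).trans (by norm_num))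

theorem abs_takagi_sub_phi_le {r : ℕ → ℝ} (hr : ∀ n, r n = 1 ∨ r n = -1) (h0 : r 0 = 1)
    (hpair : ∀ k, r (2 * k + 2) = -r (2 * k + 1)) (x : ℝ) :
    |takagi r x - phi x| ≤ phi (2 * x) / 2 := by
  set a : ℕ → ℝ := fun n => phi (2 ^ n * x) / 2 ^ n with ha
  have hanti : Antitone a := phi_two_pow_div_antitone x
  have hpartial : ∀ m : ℕ, |∑ n ∈ Finset.range (2 * m + 1), r n / 2 ^ n * phi (2 ^ n * x) - phi x|
      ≤ a 1 - a (2 * m + 1) := by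
    intro m
    induction m with
    | zero => simp [h0]
    | succ m ih =>
      have h12 := hanti (show 2 * m + 1 ≤ 2 * m + 2 by omega)
      have h23 := hanti (show 2 * m + 2 ≤ 2 * (m + 1) + 1 by omega)
      have hterm : ∀ n, r n / 2 ^ n * phi (2 ^ n * x) = r n * a n := fun n => by
        simp only [ha]; ring
      rw [show 2 * (m + 1) + 1 = 2 * m + 1 + 1 + 1 by ring, Finset.sum_range_succ,
        Finset.sum_range_succ, hterm (2 * m + 1), hterm (2 * m + 1 + 1), hpair m]
      rw [abs_le] at ih ⊢
      rw [show 2 * (m + 1) + 1 = 2 * m + 1 + 1 + 1 by ring] at h23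
      rcases hr (2 * m + 1) with h | h <;> rw [h] <;> constructor <;> linarith [ih.1, ih.2]
  have hlim := (((summable_takagi hr x).hasSum.tendsto_sum_nat.comp
    (Filter.tendsto_atTop_mono (fun m => by omega : ∀ m : ℕ, m ≤ 2 * m + 1)
      Filter.tendsto_id)).sub_const (phi x)).abs
  refine le_of_tendsto' hlim fun m => (hpartial m).trans ?_
  have hnn : 0 ≤ a (2 * m + 1) := div_nonneg (phi_nonneg _) (by positivity)
  have h1 : a 1 = phi (2 * x) / 2 := by simp [ha]
  linarith

/-- If the signs after the first one come in consecutive opposite pairs, then the graph of the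
signed Takagi function has height `1 / 2`. -/
theorem heightf_eq_half {r : ℕ → ℝ} (hr : ∀ n, r n = 1 ∨ r n = -1) (h0 : r 0 = 1)
    (hpair : ∀ k, r (2 * k + 2) = -r (2 * k + 1)) : heightf r = 1 / 2 := by
  have key := fun x => abs_le.1 (abs_takagi_sub_phi_le hr h0 hpair x)
  have hzero : takagi r 0 = 0 := by
    have h := key 0
    have h' : phi 0 = 0 := by simpa using phi_intCast 0
    rw [mul_zero, h'] at h
    linarith [h.1, h.2]
  have hhalf : takagi r (1 / 2) = 1 / 2 := by
    have h := key (1 / 2)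
    have h' : phi (2 * (1 / 2)) = 0 := by simpa using phi_intCast 1
    rw [h', phi_half] at h
    linarith [h.1, h.2]
  have hmax : IsGreatest (takagi r '' Set.Icc 0 1) (1 / 2) := by
    refine ⟨⟨1 / 2, by norm_num, hhalf⟩, ?_⟩
    rintro _ ⟨x, -, rfl⟩
    linarith [(key x).2, phi_two_mul_le_one_sub x]
  have hmin : IsLeast (takagi r '' Set.Icc 0 1) 0 := by
    refine ⟨⟨0, by norm_num, hzero⟩, ?_⟩
    rintro _ ⟨x, -, rfl⟩
    linarith [(key x).1, phi_two_mul_le x]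
  rw [heightf, hmax.csSup_eq, hmin.csInf_eq, sub_zero]

/-- The sign sequence `1, e₀, -e₀, e₁, -e₁, …` where `eₖ` is `1` or `-1` according to `b k`. -/
def pairedSigns (b : ℕ → Bool) : ℕ → ℝ
  | 0 => 1
  | n + 1 => (-1) ^ n * if b (n / 2) then 1 else -1

theorem pairedSigns_eq_or (b : ℕ → Bool) (n : ℕ) :
    pairedSigns b n = 1 ∨ pairedSigns b n = -1 := by
  cases n with
  | zero => exact Or.inl rfl
  | succ n =>
    rw [pairedSigns]
    rcases neg_one_pow_eq_or ℝ n with h | h <;> rw [h] <;> split_ifs <;> simp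

theorem pairedSigns_odd (b : ℕ → Bool) (k : ℕ) :
    pairedSigns b (2 * k + 1) = if b k then 1 else -1 := by
  simp [pairedSigns]

theorem pairedSigns_even (b : ℕ → Bool) (k : ℕ) :
    pairedSigns b (2 * k + 2) = -pairedSigns b (2 * k + 1) := by
  rw [pairedSigns_odd, pairedSigns, show (2 * k + 1) / 2 = k by omega, pow_succ, pow_mul]
  split_ifs <;> norm_num

theorem pairedSigns_injective : Function.Injective pairedSigns := by
  intro b c h
  funext k
  have hk := congrFun h (2 * k + 1)
  rw [pairedSigns_odd, pairedSigns_odd] at hk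
  cases hb : b k <;> cases hc : c k <;> simp [hb, hc] at hk ⊢ <;> norm_num at hk

/-- There are uncountably many sign sequences `r ∈ {-1,1}^ℕ` with
`height(f_r) = 1/2`. -/
theorem uncountably_many_height_half :
    ¬ {r : ℕ → ℝ | (∀ n, r n = 1 ∨ r n = -1) ∧ heightf r = 1 / 2}.Countable := by
  intro h
  have hpre := h.preimage pairedSigns_injective
  have hc : Countable (ℕ → Bool) := Set.countable_univ_iff.1 <| hpre.mono fun b _ =>
    And.intro (pairedSigns_eq_or b)
      (heightf_eq_half (pairedSigns_eq_or b) rfl (pairedSigns_even b))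
  rw [← Cardinal.mk_le_aleph0_iff] at hc
  exact (Cardinal.cantor Cardinal.aleph0).not_ge (by simpa using hc)
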